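/- For all integers T ≥ B ≥ 1 and α ≥ 2, there exist a finite field F_q and a streaming code with source alphabet F_q^T and channel alphabet F_q^{T+B} (hence of rate T/(T+B)) that corrects erasure bursts of length B with delay T and also corrects erasure bursts of length αB with delay αT + B. -/

import Mathlib

/-- The channel input stream produced by the streaming code `f` (a sequence of causal
encoding functions `f t : S^(t+1) → X`) from the source stream `s`. -/
def chanStream {S X : Type*} (f : ∀ t : ℕ, (Fin (t + 1) → S) → X) (s : ℕ → S) (t : ℕ) : X :=
  f t fun i => s i.val

/-- Output at time `t` of the burst-erasure channel with burst length `B` and burst starting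
position `j`: `none` (an erasure) for `j ≤ t ≤ j + B - 1`, and the channel input otherwise. -/
def burstOut {S X : Type*} (f : ∀ t : ℕ, (Fin (t + 1) → S) → X) (B j : ℕ) (s : ℕ → S)
    (t : ℕ) : Option X :=
  if j ≤ t ∧ t ≤ j + B - 1 then none else some (chanStream f s t)

/-- The streaming code `f` corrects erasure bursts of length `B` with delay `T`: there are
decoding functions `γ t` recovering `s t` from the channel outputs `y 0, …, y (t + T)`,
for every source stream `s` and every burst starting position `j`. -/
def Corrects {S X : Type*} (f : ∀ t : ℕ, (Fin (t + 1) → S) → X) (B T : ℕ) : Prop :=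
  ∃ γ : ∀ t : ℕ, (Fin (t + T + 1) → Option X) → S,
    ∀ (s : ℕ → S) (j t : ℕ), γ t (fun i => burstOut f B j s i.val) = s t

open Finset in
lemma vand_aux {F : Type} [Field F] (y : ℕ → F) (A : Finset ℕ)
    (hinj : ∀ a ∈ A, ∀ b ∈ A, y a = y b → a = b) (hne : ∀ a ∈ A, y a ≠ 0)
    (k0 : ℕ) (v : ℕ → F)
    (h : ∀ m, m < A.card → ∑ a ∈ A, y a ^ (k0 + m) * v a = 0) :
    ∀ a ∈ A, v a = 0 := by
  classical
  have key : ∀ P : Polynomial F, P.natDegree < A.card →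
      ∑ a ∈ A, P.eval (y a) * (y a ^ k0 * v a) = 0 := by
    intro P hP
    have : ∀ a ∈ A, P.eval (y a) * (y a ^ k0 * v a)
        = ∑ m ∈ range (P.natDegree + 1), P.coeff m * (y a ^ (k0 + m) * v a) := by
      intro a _
      rw [Polynomial.eval_eq_sum_range, Finset.sum_mul]
      refine Finset.sum_congr rfl fun m _ => ?_
      ring
    rw [Finset.sum_congr rfl this, Finset.sum_comm]
    refine Finset.sum_eq_zero fun m hm => ?_
    rw [← Finset.mul_sum, h m (by have := Finset.mem_range.1 hm; omega), mul_zero]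
  intro a ha
  have hd : (∏ b ∈ A.erase a, (Polynomial.X - Polynomial.C (y b))).natDegree < A.card := by
    rw [Polynomial.natDegree_prod_of_monic _ _ (fun b _ => Polynomial.monic_X_sub_C _)]
    simp only [Polynomial.natDegree_X_sub_C, Finset.sum_const, smul_eq_mul, mul_one]
    exact Finset.card_erase_lt_of_mem ha
  have h1 := key _ hd
  rw [Finset.sum_eq_single a] at h1
  · rw [Polynomial.eval_prod] at h1
    rcases mul_eq_zero.1 h1 with h2 | h2
    · exfalso
      obtain ⟨b, hb, hb0⟩ := Finset.prod_eq_zero_iff.1 h2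
      simp only [Polynomial.eval_sub, Polynomial.eval_X, Polynomial.eval_C] at hb0
      have := hinj a ha b (Finset.mem_of_mem_erase hb) (sub_eq_zero.1 hb0)
      exact (Finset.ne_of_mem_erase hb) this.symm
    · rcases mul_eq_zero.1 h2 with h3 | h3
      · exact absurd h3 (pow_ne_zero _ (hne a ha))
      · exact h3
  · intro b hb hba
    rw [Polynomial.eval_prod, Finset.prod_eq_zero (Finset.mem_erase.2 ⟨hba, hb⟩), zero_mul]
    · simp
  · exact fun h => absurd ha h

lemma vand_int {F : Type} [Field F] (T : ℕ) (y : ℕ → F)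
    (hinj : ∀ a < T, ∀ b < T, y a = y b → a = b) (hne : ∀ a < T, y a ≠ 0)
    (S : Finset ℕ) (hS : ∀ a ∈ S, a < T) (lo hi k0 k1 : ℕ) (hc : hi - lo ≤ k1 - k0)
    (v : ℕ → F) (hv : ∀ a ∈ S, ¬ (lo ≤ a ∧ a < hi) → v a = 0)
    (h : ∀ k, k0 ≤ k → k < k1 → ∑ a ∈ S, y a ^ k * v a = 0) :
    ∀ a ∈ S, v a = 0 := by
  classical
  have hcard : (S.filter fun a => lo ≤ a ∧ a < hi).card ≤ hi - lo := by
    rw [← Nat.card_Ico]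
    apply Finset.card_le_card
    intro a ha
    simpa using (Finset.mem_filter.1 ha).2
  have := vand_aux y (S.filter fun a => lo ≤ a ∧ a < hi)
    (fun a ha b hb => hinj a (hS a (Finset.mem_filter.1 ha).1) b (hS b (Finset.mem_filter.1 hb).1))
    (fun a ha => hne a (hS a (Finset.mem_filter.1 ha).1)) k0 v (by
      intro m hm
      rw [← h (k0 + m) (by omega) (by omega)]
      refine Finset.sum_subset (Finset.filter_subset _ _) fun a ha hna => ?_
      rw [hv a ha (fun hh => hna (Finset.mem_filter.2 ⟨ha, hh⟩)), mul_zero])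
  intro a ha
  by_cases hh : lo ≤ a ∧ a < hi
  · exact this a (Finset.mem_filter.2 ⟨ha, hh⟩)
  · exact hv a ha hh

/-- parity of the first code -/
def parI {F : Type} [Field F] (y : ℕ → F) (B T : ℕ) (e : ℤ → ℕ → F) (k : ℕ) (t : ℤ) : F :=
  e (t - T) k + ∑ a ∈ Finset.Ico B T, y a ^ k * e (t - T - k + a) a

/-- parity of the second (interleaved, opposite diagonal) code -/
def parII {F : Type} [Field F] (y : ℕ → F) (B T β : ℕ) (e : ℤ → ℕ → F) (k : ℕ) (t : ℤ) : F :=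
  e (t - β * T) (T - 1 - k)
    + ∑ a ∈ Finset.range (T - B), y a ^ k * e (t - β * (k + a + 1)) a

/-- combined parity -/
def parQ {F : Type} [Field F] (y : ℕ → F) (B T β : ℕ) (e : ℤ → ℕ → F) (k : ℕ) (t : ℤ) : F :=
  parI y B T e k t + parII y B T β e k (t - T - B)

section core
variable {F : Type} [Field F] (y : ℕ → F) (B T β : ℕ)

/-- the row step using the first code -/
lemma rowI (hinj : ∀ a < T, ∀ b < T, y a = y b → a = b) (hne : ∀ a < T, y a ≠ 0)
    (hBT : B ≤ T) (e : ℤ → ℕ → F) (E : ℤ)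
    (hE : ∀ i a, E ≤ i → e i a = 0)
    (hP : ∀ t k, E ≤ t → t < E + T → k < B → parI y B T e k t = 0)
    (a : ℕ) (ha : a < T) (hrow : ∀ a' < a, ∀ i, e i a' = 0)
    (n : ℕ) (hn : 1 ≤ n) (hnB : n ≤ B) : e (E - n) a = 0 := by
  have hnon : ∀ a' ∈ Finset.Ico B T, e (E - n - a + a') a' = 0 := by
    refine vand_int T y hinj hne (Finset.Ico B T) (fun a ha => (Finset.mem_Ico.1 ha).2)
      (max B a) (min T (a + n)) (a + n - T) (min a B) (by omega)
      (fun a' => e (E - n - a + a') a') ?_ ?_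
    · intro a' ha' hh
      rw [Finset.mem_Ico] at ha'
      by_cases h1 : a' < a
      · exact hrow a' h1 _
      · exact hE _ _ (by omega)
    · intro k hk0 hk1
      have := hP (E - n - a + T + k) k (by omega) (by omega) (by omega)
      unfold parI at this
      rw [hrow k (by omega), zero_add] at this
      rw [← this]
      refine Finset.sum_congr rfl fun a' _ => ?_
      congr 2
      ring
  by_cases haB : B ≤ a
  · have := hnon a (Finset.mem_Ico.2 ⟨haB, ha⟩)
    simpa using this
  · have := hP (E - n + T) a (by omega) (by omega) (by omega)
    unfold parI at this
    rw [Finset.sum_eq_zero, add_zero] at this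
    · rw [← this]; congr 1; ring
    · intro a' ha'
      rw [← mul_zero (y a' ^ a), ← hnon a' ha']
      congr 2
      ring

lemma userI (hinj : ∀ a < T, ∀ b < T, y a = y b → a = b) (hne : ∀ a < T, y a ≠ 0)
    (hBT : B ≤ T) (e : ℤ → ℕ → F)
    (h0 : ∀ i a, i < 0 → e i a = 0) (hE : ∀ i a, (B : ℤ) ≤ i → e i a = 0) (t0 : ℤ)
    (ht0 : 0 ≤ t0)
    (hQ : ∀ t k, (B : ℤ) ≤ t → t ≤ t0 + T → k < B → parQ y B T β e k t = 0)
    (a : ℕ) (ha : a < T) : e t0 a = 0 := by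
  by_cases htB : (B : ℤ) ≤ t0
  · exact hE _ _ htB
  have hP : ∀ t k, (B : ℤ) ≤ t → t ≤ t0 + T → k < B → parI y B T e k t = 0 := by
    intro t k h1 h2 h3
    have := hQ t k h1 h2 h3
    unfold parQ at this
    have h4 : parII y B T β e k (t - T - B) = 0 := by
      unfold parII
      rw [h0 _ _ (by have : (0:ℤ) ≤ β * T := by positivity
                     omega), zero_add]
      refine Finset.sum_eq_zero fun a' _ => ?_
      rw [h0 _ _ (by have : (0:ℤ) ≤ β * (k + a' + 1) := by positivity
                     omega), mul_zero]
    rwa [h4, add_zero] at this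
  have hnon : ∀ m : ℤ, ∀ a' ∈ Finset.Ico B T, e (a' - m) a' = 0 := by
    intro m
    by_cases hm : m ≤ 0
    · intro a' ha'
      rw [Finset.mem_Ico] at ha'
      exact hE _ _ (by omega)
    obtain ⟨m, rfl⟩ := Int.eq_ofNat_of_zero_le (le_of_lt (not_le.1 hm))
    refine vand_int T y hinj hne (Finset.Ico B T) (fun a ha => (Finset.mem_Ico.1 ha).2)
      (max B m) (min T (B + m)) (B + m - T) (min B m) (by omega)
      (fun a' => e (a' - m) a') ?_ ?_
    · intro a' ha' hh
      rw [Finset.mem_Ico] at ha'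
      by_cases h1 : a' < m
      · exact h0 _ _ (by omega)
      · exact hE _ _ (by omega)
    · intro k hk0 hk1
      have := hP (T + k - m) k (by omega) (by omega) (by omega)
      unfold parI at this
      rw [h0 _ _ (by omega), zero_add] at this
      rw [← this]
      refine Finset.sum_congr rfl fun a' _ => ?_
      congr 2
      ring
  by_cases haB : B ≤ a
  · have := hnon (a - t0) a (Finset.mem_Ico.2 ⟨haB, ha⟩)
    simpa using this
  · have := hP (t0 + T) a (by omega) (by omega) (by omega)
    unfold parI at this
    rw [Finset.sum_eq_zero, add_zero] at this
    · rw [← this]; congr 1; ring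
    · intro a' ha'
      rw [← mul_zero (y a' ^ a), ← hnon (a - t0) a' ha']
      congr 2
      ring

/-- parities of the second code are clean from `β * B` on -/
lemma cleanII (e : ℤ → ℕ → F) (hBT : B ≤ T)
    (hE : ∀ i a, ((β : ℤ) + 1) * B ≤ i → e i a = 0) (W : ℤ)
    (hQ : ∀ t k, ((β : ℤ) + 1) * B ≤ t → t ≤ W + T + B → k < B → parQ y B T β e k t = 0)
    (t : ℤ) (k : ℕ) (hk : k < B) (h1 : (β : ℤ) * B ≤ t) (h2 : t ≤ W) :
    parII y B T β e k t = 0 := by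
  have e1 : ((β : ℤ) + 1) * B = β * B + B := by ring
  rw [e1] at hE hQ
  have := hQ (t + T + B) k (by omega) (by omega) hk
  unfold parQ at this
  have h4 : parI y B T e k (t + T + B) = 0 := by
    unfold parI
    rw [hE _ _ (by omega), zero_add]
    refine Finset.sum_eq_zero fun a' ha' => ?_
    rw [Finset.mem_Ico] at ha'
    rw [hE _ _ (by omega), mul_zero]
  rw [h4, zero_add] at this
  rw [← this]; congr 1; ring

/-- nonurgent symbols of the second code -/
lemma nonurgent (hinj : ∀ a < T, ∀ b < T, y a = y b → a = b) (hne : ∀ a < T, y a ≠ 0)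
    (hBT : B ≤ T) (hβ : 1 ≤ β) (e : ℤ → ℕ → F)
    (h0 : ∀ i a, i < 0 → e i a = 0) (hE : ∀ i a, ((β : ℤ) + 1) * B ≤ i → e i a = 0) (t0 : ℤ)
    (ht0 : 0 ≤ t0)
    (hQ : ∀ t k, ((β : ℤ) + 1) * B ≤ t → t ≤ t0 + β * T + T + B → k < B →
      parQ y B T β e k t = 0) (j : ℕ) :
    ∀ a < T - B, ∀ i : ℤ, i < ((j : ℤ) - a) * β → e i a = 0 := by
  have hII := cleanII y B T β e hBT hE (t0 + β * T) hQ
  have e1 : ((β : ℤ) + 1) * B = β * B + B := by ring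
  rw [e1] at hE hQ
  have hbb : (β : ℤ) * B ≤ β * T := by gcongr
  induction j with
  | zero =>
    intro a _ i hi
    refine h0 i a (lt_of_lt_of_le hi ?_)
    have : (0 : ℤ) ≤ a * β := by positivity
    push_cast
    linarith
  | succ j ih =>
    -- rows that are completely known
    have hrows : ∀ a, a < T - B → a + B ≤ j → ∀ i, e i a = 0 := by
      intro a
      induction a using Nat.strong_induction_on with
      | _ a iha =>
        intro ha haj i
        have hP : ∀ t k, (β : ℤ) * B + B ≤ t → t < (β : ℤ) * B + B + T → k < B →
            parI y B T e k t = 0 := by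
          intro t k h1 h2 h3
          have := hQ t k h1 (by omega) h3
          unfold parQ at this
          have h4 : parII y B T β e k (t - T - B) = 0 := by
            unfold parII
            rw [h0 _ _ (by omega), zero_add]
            refine Finset.sum_eq_zero fun a' ha' => ?_
            rw [Finset.mem_range] at ha'
            rw [ih a' ha' _ ?_, mul_zero]
            have hj : (B : ℤ) * β ≤ j * β := by
              gcongr; omega
            have hk : (0 : ℤ) ≤ β * k := by positivity
            have : (t - T - B : ℤ) < β * B := by omega
            nlinarith
          rwa [h4, add_zero] at this
        by_cases hi : i < β * B
        · refine ih a ha i (lt_of_lt_of_le hi ?_)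
          rw [mul_comm]
          gcongr
          omega
        by_cases hi2 : β * B + B ≤ i
        · exact hE _ _ hi2
        have := rowI y B T hinj hne hBT e (β * B + B) hE hP a (by omega)
          (fun a' h i => iha a' h (by omega) (by omega) i)
          (β * B + B - i).toNat (by omega) (by omega)
        rw [← this]
        congr 1
        omega
    -- codeword step
    have hcw : ∀ r : ℕ, r < β → ∀ a ∈ Finset.range (T - B), e (j * β + r - β * a) a = 0 := by
      intro r hr
      refine vand_int T y hinj hne (Finset.range (T - B))
        (fun a ha => by have := Finset.mem_range.1 ha; omega)
        (j + 1 - B) (min (T - B) (j + 1)) (B - 1 - j) (min B (T - 1 - j)) (by omega)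
        (fun a' => e (j * β + r - β * a') a') ?_ ?_
      · intro a' ha' hh
        rw [Finset.mem_range] at ha'
        by_cases h1 : a' + B ≤ j
        · exact hrows a' ha' h1 _
        · refine h0 _ _ ?_
          have h2 : j + 1 ≤ a' := by omega
          have h3 : (β : ℤ) * (j + 1) ≤ β * a' := by gcongr; omega
          have h4 : (r : ℤ) < β := by omega
          linarith
      · intro k hk0 hk1
        have h4 : (r : ℤ) < β := by omega
        have a1 : (β : ℤ) * B ≤ β * (j + k + 1) := by gcongr; omega
        have a2 : (β : ℤ) * (j + k + 2) ≤ β * T := by gcongr; omega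
        have := hII (j * β + r + β * (k + 1)) k (by omega) (by linarith) (by linarith)
        unfold parII at this
        rw [h0 _ _ (by linarith), zero_add] at this
        rw [← this]
        refine Finset.sum_congr rfl fun a' _ => ?_
        congr 2
        ring
    intro a ha i hi
    by_cases hi2 : i < ((j : ℤ) - a) * β
    · exact ih a ha i hi2
    have := hcw (i - ((j : ℤ) - a) * β).toNat (by push_cast at hi; have : (((j:ℤ) + 1 - a) * β) = (j - a) * β + β := by ring
                                                  omega) a (Finset.mem_range.2 ha)
    rw [← this]
    congr 1
    rw [Int.toNat_of_nonneg (by omega)]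
    ring

lemma userII (hinj : ∀ a < T, ∀ b < T, y a = y b → a = b) (hne : ∀ a < T, y a ≠ 0)
    (hBT : B ≤ T) (hβ : 1 ≤ β) (e : ℤ → ℕ → F)
    (h0 : ∀ i a, i < 0 → e i a = 0) (hE : ∀ i a, ((β : ℤ) + 1) * B ≤ i → e i a = 0) (t0 : ℤ)
    (ht0 : 0 ≤ t0)
    (hrng : ∀ i a, T ≤ a → e i a = 0)
    (hQ : ∀ t k, ((β : ℤ) + 1) * B ≤ t → t ≤ t0 + β * T + T + B → k < B →
      parQ y B T β e k t = 0) (a : ℕ) : e t0 a = 0 := by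
  have hbb : (β : ℤ) * B ≤ β * T := by gcongr
  have e1 : ((β : ℤ) + 1) * B = β * B + B := by ring
  have hfirst : ∀ i, i ≤ t0 → i < β * B → ∀ a, e i a = 0 := by
    intro i hi hib a
    by_cases hi0 : i < 0
    · exact h0 _ _ hi0
    by_cases haT : T ≤ a
    · exact hrng _ _ haT
    have hnon : ∀ a < T - B, ∀ i : ℤ, e i a = 0 := by
      intro a ha i
      refine nonurgent y B T β hinj hne hBT hβ e h0 hE t0 ht0 hQ (a + i.toNat + 1) a ha i ?_
      push_cast
      have : (1 : ℤ) ≤ β := by omega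
      have h2 : i ≤ i.toNat := Int.self_le_toNat i
      nlinarith
    by_cases ha : a < T - B
    · exact hnon a ha i
    have := cleanII y B T β e hBT hE (t0 + β * T) hQ (i + β * T) (T - 1 - a) (by omega)
      (by omega) (by omega)
    unfold parII at this
    rw [Finset.sum_eq_zero, add_zero] at this
    · rw [← this]
      congr 1
      · ring
      · omega
    · intro a' ha'
      rw [hnon a' (Finset.mem_range.1 ha'), mul_zero]
  by_cases ht : t0 < β * B
  · exact hfirst t0 le_rfl ht a
  have hpre : ∀ i : ℤ, i < β * B → ∀ a, e i a = 0 := fun i hi a => hfirst i (by omega) hi a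
  rw [e1] at hE hQ
  have hBB : (B : ℤ) ≤ β * B := by
    have : (1 : ℤ) ≤ β := by omega
    nlinarith
  have hP : ∀ t k, (β : ℤ) * B + B ≤ t → t < (β : ℤ) * B + B + T → k < B →
      parI y B T e k t = 0 := by
    intro t k h1 h2 h3
    have hTT : (0 : ℤ) ≤ β * T := by positivity
    have := hQ t k h1 (by omega) h3
    unfold parQ at this
    have h4 : parII y B T β e k (t - T - B) = 0 := by
      unfold parII
      rw [hpre _ (by omega), zero_add]
      refine Finset.sum_eq_zero fun a' ha' => ?_
      rw [hpre _ ?_, mul_zero]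
      have : (0 : ℤ) ≤ β * (k + a' + 1) := by positivity
      omega
    rwa [h4, add_zero] at this
  have hall : ∀ a, ∀ i, e i a = 0 := by
    intro a
    induction a using Nat.strong_induction_on with
    | _ a iha =>
      intro i
      by_cases haT : T ≤ a
      · exact hrng _ _ haT
      by_cases hi : i < β * B
      · exact hpre i hi a
      by_cases hi2 : β * B + B ≤ i
      · exact hE _ _ hi2
      have := rowI y B T hinj hne hBT e (β * B + B) hE hP a (by omega)
        (fun a' h i => iha a' h i)
        (β * B + B - i).toNat (by omega) (by omega)
      rw [← this]
      congr 1
      omega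
  exact hall a t0

lemma parQ_congr (hBT : B ≤ T) (e e' : ℤ → ℕ → F) (k : ℕ) (t : ℤ)
    (h : ∀ i a, i ≤ t → e i a = e' i a) : parQ y B T β e k t = parQ y B T β e' k t := by
  unfold parQ parI parII
  have hTT : (0 : ℤ) ≤ β * T := by positivity
  congr 1
  · congr 1
    · exact h _ _ (by omega)
    · refine Finset.sum_congr rfl fun a ha => ?_
      rw [Finset.mem_Ico] at ha
      rw [h _ _ (by omega)]
  · congr 1
    · exact h _ _ (by omega)
    · refine Finset.sum_congr rfl fun a ha => ?_
      have : (0 : ℤ) ≤ β * (k + a + 1) := by positivity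
      rw [h _ _ (by omega)]

lemma parQ_sub (e e' : ℤ → ℕ → F) (k : ℕ) (t : ℤ) :
    parQ y B T β (fun i a => e i a - e' i a) k t
      = parQ y B T β e k t - parQ y B T β e' k t := by
  unfold parQ parI parII
  simp only [mul_sub, Finset.sum_sub_distrib]
  ring

lemma parQ_shift (e : ℤ → ℕ → F) (k : ℕ) (t j : ℤ) :
    parQ y B T β (fun i a => e (i + j) a) k t = parQ y B T β e k (t + j) := by
  have hc : ∀ i i' a, i + j = i' → e (i + j) a = e i' a := fun i i' a h => by rw [h]
  unfold parQ parI parII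
  refine congrArg₂ _ (congrArg₂ _ ?_ ?_) (congrArg₂ _ ?_ ?_)
  · exact hc _ _ _ (by ring)
  · refine Finset.sum_congr rfl fun a _ => ?_
    exact congrArg _ (hc _ _ _ (by ring))
  · exact hc _ _ _ (by ring)
  · refine Finset.sum_congr rfl fun a _ => ?_
    exact congrArg _ (hc _ _ _ (by ring))

/-- extension by zero of a stream -/
def extS (T : ℕ) (s : ℕ → Fin T → F) (i : ℤ) (a : ℕ) : F :=
  if h : 0 ≤ i ∧ a < T then s i.toNat ⟨a, h.2⟩ else 0

/-- the encoder -/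
def encS (t : ℕ) (s : Fin (t + 1) → (Fin T → F)) : Fin (T + B) → F := fun x =>
  Fin.addCases (fun a => s (Fin.last t) a)
    (fun k => parQ y B T β
      (extS T (fun i => if h : i < t + 1 then s ⟨i, h⟩ else 0)) k.val t) x

lemma chan_sys (s : ℕ → Fin T → F) (t : ℕ) (a : Fin T) :
    chanStream (encS y B T β) s t (Fin.castAdd B a) = s t a := by
  simp [chanStream, encS]

lemma chan_par (hBT : B ≤ T) (s : ℕ → Fin T → F) (t : ℕ) (k : Fin B) :
    chanStream (encS y B T β) s t (Fin.natAdd T k) = parQ y B T β (extS T s) k.val t := by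
  simp only [chanStream, encS, Fin.addCases_right]
  refine parQ_congr y B T β hBT _ _ _ _ fun i a hi => ?_
  unfold extS
  by_cases h : 0 ≤ i ∧ a < T
  · rw [dif_pos h, dif_pos h]
    beta_reduce
    rw [dif_pos (by omega)]
  · rw [dif_neg h, dif_neg h]

lemma corrects_of_inj {S X : Type} [Nonempty S] (f : ∀ t : ℕ, (Fin (t + 1) → S) → X) (L D : ℕ)
    (hL : 1 ≤ L)
    (hsys : ∀ s s' t, chanStream f s t = chanStream f s' t → s t = s' t)
    (h : ∀ (s s' : ℕ → S) (j t : ℕ), j ≤ t → t < j + L →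
      (∀ i, i ≤ t + D → ¬ (j ≤ i ∧ i < j + L) → chanStream f s i = chanStream f s' i) →
      s t = s' t) : Corrects f L D := by
  classical
  have key : ∀ (s s' : ℕ → S) (j j' t : ℕ),
      (∀ i, i ≤ t + D → burstOut f L j s i = burstOut f L j' s' i) → s t = s' t := by
    intro s s' j j' t hh
    have ht := hh t (by omega)
    by_cases hj : j ≤ t ∧ t ≤ j + L - 1
    · by_cases hj' : j' ≤ t ∧ t ≤ j' + L - 1
      · have hjj : j = j' := by
          rcases lt_trichotomy j j' with hlt | heq | hlt
          · have := hh j (by omega)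
            unfold burstOut at this
            rw [if_pos (by omega), if_neg (by omega)] at this
            cases this
          · exact heq
          · have := hh j' (by omega)
            unfold burstOut at this
            rw [if_neg (by omega), if_pos (by omega)] at this
            cases this
        subst hjj
        refine h s s' j t hj.1 (by omega) fun i hi hni => ?_
        have := hh i hi
        unfold burstOut at this
        rw [if_neg (by omega), if_neg (by omega)] at this
        exact Option.some.inj this
      · unfold burstOut at ht
        rw [if_pos hj, if_neg hj'] at ht
        cases ht
    · by_cases hj' : j' ≤ t ∧ t ≤ j' + L - 1
      · unfold burstOut at ht
        rw [if_neg hj, if_pos hj'] at ht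
        cases ht
      · unfold burstOut at ht
        rw [if_neg hj, if_neg hj'] at ht
        exact hsys _ _ _ (Option.some.inj ht)
  refine ⟨fun t z => if hz : ∃ p : (ℕ → S) × ℕ, (fun i : Fin (t + D + 1) =>
    burstOut f L p.2 p.1 i.val) = z then hz.choose.1 t else Classical.arbitrary S, ?_⟩
  intro s j t
  have hz : ∃ p : (ℕ → S) × ℕ, (fun i : Fin (t + D + 1) =>
    burstOut f L p.2 p.1 i.val) = fun i : Fin (t + D + 1) => burstOut f L j s i.val := ⟨(s, j), rfl⟩
  beta_reduce
  rw [dif_pos hz]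
  refine key _ _ hz.choose.2 j t fun i hi => ?_
  exact congrFun hz.choose_spec ⟨i, by omega⟩

/-- reduction of a correction property to a statement on differences -/
lemma corrects_enc (hBT : B ≤ T) (L D : ℕ) (hL : 1 ≤ L)
    (h : ∀ (e : ℤ → ℕ → F) (t0 : ℤ), (∀ i a, i < 0 → e i a = 0) →
      (∀ i a, (L : ℤ) ≤ i → e i a = 0) → (∀ i a, T ≤ a → e i a = 0) → 0 ≤ t0 →
      (∀ t k, (L : ℤ) ≤ t → t ≤ t0 + D → k < B → parQ y B T β e k t = 0) →
      ∀ a < T, e t0 a = 0) : Corrects (encS y B T β) L D := by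
  have hsys : ∀ s s' t, chanStream (encS y B T β) s t = chanStream (encS y B T β) s' t →
      s t = s' t := by
    intro s s' t hh
    funext a
    rw [← chan_sys y B T β s t a, hh, chan_sys]
  refine corrects_of_inj _ L D hL hsys ?_
  intro s s' j t hjt htj hh
  -- the truncated shifted difference
  have hout : ∀ (i : ℤ) (a : ℕ), i ≤ t + D → ¬ ((j : ℤ) ≤ i ∧ i < j + L) →
      extS T s i a - extS T s' i a = 0 := by
    intro i a hi hni
    unfold extS
    by_cases hc : 0 ≤ i ∧ a < T
    · rw [dif_pos hc, dif_pos hc, hsys s s' i.toNat (hh i.toNat (by omega) (by omega)), sub_self]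
    · rw [dif_neg hc, dif_neg hc, sub_self]
  let d : ℤ → ℕ → F := fun i a => extS T s i a - extS T s' i a
  let d' : ℤ → ℕ → F := fun i a => if i ≤ t + D then d i a else 0
  have hd' : ∀ (i : ℤ) (a : ℕ), i ≤ t + D → d' i a = d i a := fun i a hi => if_pos hi
  have hd'0 : ∀ i a, ¬ ((j : ℤ) ≤ i ∧ i < j + L) → d' i a = 0 := by
    intro i a hi
    by_cases h1 : i ≤ t + D
    · rw [hd' i a h1]; exact hout i a h1 hi
    · exact if_neg h1
  have := h (fun i a => d' (i + j) a) (t - j)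
    (fun i a hi => hd'0 _ _ (by omega)) (fun i a hi => hd'0 _ _ (by omega))
    (fun i a ha => by
      have : d (i + j) a = 0 := by
        show extS T s _ a - extS T s' _ a = 0
        unfold extS
        rw [dif_neg (by omega), dif_neg (by omega), sub_self]
      show (if _ then d (i + j) a else 0) = 0
      rw [this, ite_self]) (by omega)
    (fun τ k h1 h2 hk => by
      rw [parQ_shift y B T β d', parQ_congr y B T β hBT d' d k _ (fun i a hi => hd' i a (by omega))]
      show parQ y B T β (fun i a => extS T s i a - extS T s' i a) k (τ + j) = 0
      rw [parQ_sub]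
      have hn : τ + j = ((τ + j).toNat : ℤ) := by omega
      rw [hn, ← chan_par y B T β hBT s _ ⟨k, hk⟩, ← chan_par y B T β hBT s' _ ⟨k, hk⟩,
        hh _ (by omega) (by omega), sub_self])
  funext a
  have h3 := this a.val a.isLt
  beta_reduce at h3
  rw [hd' _ _ (by omega)] at h3
  have h4 : extS T s (t - j + j) a.val - extS T s' (t - j + j) a.val = 0 := h3
  unfold extS at h4
  rw [dif_pos ⟨by omega, a.isLt⟩, dif_pos ⟨by omega, a.isLt⟩] at h4
  have h5 : ((t : ℤ) - j + j).toNat = t := by omega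
  rw [h5] at h4
  exact sub_eq_zero.1 h4

end core

/-- DE-SCo achievability: for `T ≥ B ≥ 1` and `α ≥ 2` there is a finite field `F` and a
streaming code with source alphabet `F^T` and channel alphabet `F^(T+B)` (rate `T/(T+B)`)
correcting bursts of length `B` with delay `T` and bursts of length `α*B` with delay `α*T + B`. -/
theorem stmt_1 (B T α : ℕ) (hB : 1 ≤ B) (hBT : B ≤ T) (hα : 2 ≤ α) :
    ∃ (F : Type) (_ : Field F) (_ : Fintype F)
      (f : ∀ t : ℕ, (Fin (t + 1) → (Fin T → F)) → (Fin (T + B) → F)),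
      Corrects f B T ∧ Corrects f (α * B) (α * T + B) := by
  obtain ⟨p, hpT, hp⟩ := Nat.exists_infinite_primes (T + 1)
  have : Fact p.Prime := ⟨hp⟩
  obtain ⟨β, rfl⟩ : ∃ β, α = β + 1 := ⟨α - 1, by omega⟩
  let y : ℕ → ZMod p := fun a => ((a + 1 : ℕ) : ZMod p)
  have hinj : ∀ a < T, ∀ b < T, y a = y b → a = b := by
    intro a ha b hb hab
    have := (ZMod.natCast_eq_natCast_iff' _ _ _).1 hab
    rw [Nat.mod_eq_of_lt (by omega), Nat.mod_eq_of_lt (by omega)] at this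
    omega
  have hne : ∀ a < T, y a ≠ 0 := by
    intro a ha h
    have := Nat.le_of_dvd (by omega) ((ZMod.natCast_eq_zero_iff _ _).1 h)
    omega
  refine ⟨ZMod p, inferInstance, inferInstance, encS y B T β, ?_, ?_⟩
  · refine corrects_enc y B T β hBT B T hB ?_
    intro e t0 h0 hE _ ht0 hQ a ha
    exact userI y B T β hinj hne hBT e h0 hE t0 ht0 hQ a ha
  · refine corrects_enc y B T β hBT _ _ (by nlinarith) ?_
    intro e t0 h0 hE hr ht0 hQ a _
    push_cast at hE hQ
    refine userII y B T β hinj hne hBT (by omega) e h0 hE t0 ht0 hr ?_ a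
    intro t k h1 h2 hk
    exact hQ t k h1 (by linarith) hk
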